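/- arXiv:2601.15723 — 2 statements merged into one kernel-verified Lean document; each statement's English description precedes it below -/
import Mathlib

section
/- Let S be a nonempty finite set of n distinct points in ℝ³. Then n² ≤ n_xy · n*_{yz|x} · n_zx, where n_xy and n_zx are the cardinalities of the projections of S onto the xy- and zx-planes, and n*_{yz|x} is the maximum number of distinct yz-projection points among all points of S sharing a common x-coordinate. -/
open Finset in
/-- A finite set in a product is at most as large as the product of its two projections. -/
theorem card_le_card_image_fst_mul_card_image_snd {α β : Type*} [DecidableEq α] [DecidableEq β]
    (T : Finset (α × β)) : T.card ≤ (T.image Prod.fst).card * (T.image Prod.snd).card := by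
  rw [← card_product]
  exact card_le_card subset_product

open Finset in
/-- The size of the image of `g` is the sum of the sizes of the images under `g` of
the fibres of `f`, provided that
`f` factors through `g`. -/
theorem card_image_eq_sum_card_image_fiber {α β γ : Type*} [DecidableEq β] [DecidableEq γ]
    (S : Finset α) (f : α → β) (g : α → γ) (h : γ → β) (hf : ∀ a, h (g a) = f a) :
    (S.image g).card = ∑ x ∈ S.image f, ((S.filter (fun a => f a = x)).image g).card := by
  have hmaps : Set.MapsTo h (S.image g) (S.image f) := by
    intro c hc
    obtain ⟨a, ha, rfl⟩ := mem_image.1 hc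
    rw [hf]
    exact mem_image_of_mem f ha
  rw [card_eq_sum_card_fiberwise hmaps]
  refine sum_congr rfl fun x _ => ?_
  rw [filter_image]
  simp only [hf]

/-- strong Loomis–Whitney-type inequality in ℝ³:
`n² ≤ n_xy · n*_{yz|x} · n_zx`. -/
theorem stmt_8 (S : Finset (ℝ × ℝ × ℝ)) (hS : S.Nonempty) :
    S.card ^ 2 ≤
      (S.image (fun p => (p.1, p.2.1))).card *
      ((S.image (fun p => p.1)).sup (fun x =>
        ((S.filter (fun p => p.1 = x)).image (fun p => p.2)).card)) *
      (S.image (fun p => (p.2.2, p.1))).card := by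
  set M := (S.image (fun p => p.1)).sup (fun x =>
        ((S.filter (fun p => p.1 = x)).image (fun p => p.2)).card)
  rw [card_image_eq_sum_card_image_fiber S (fun p => p.1) (fun p => (p.1, p.2.1)) Prod.fst
      (fun _ => rfl),
    card_image_eq_sum_card_image_fiber S (fun p => p.1) (fun p => (p.2.2, p.1)) Prod.snd
      (fun _ => rfl),
    Finset.card_eq_sum_card_image (fun p => p.1) S, Finset.sum_mul]
  refine Finset.sum_sq_le_sum_mul_sum_of_sq_le_mul _ (fun _ _ => Nat.zero_le _)
    (fun _ _ => Nat.zero_le _) fun x hx => ?_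
  set F := S.filter (fun p => p.1 = x)
  have hfst : ∀ p ∈ F, p.1 = x := fun p hp => (Finset.mem_filter.1 hp).2
  have hinj : Set.InjOn (fun p : ℝ × ℝ × ℝ => p.2) F := fun p hp q hq hpq =>
    Prod.ext ((hfst p hp).trans (hfst q hq).symm) hpq
  have hcard : (F.image (fun p => p.2)).card = F.card := Finset.card_image_of_injOn hinj
  have hle : F.card ≤ M := hcard ▸ Finset.le_sup
    (f := fun x => ((S.filter (fun p => p.1 = x)).image (fun p => p.2)).card) hx
  have hy : ((F.image (fun p => p.2)).image Prod.fst).card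
      ≤ (F.image (fun p => (p.1, p.2.1))).card := by
    have : (F.image (fun p => p.2)).image Prod.fst
        = (F.image (fun p => (p.1, p.2.1))).image Prod.snd := by
      simp only [Finset.image_image, Function.comp_def]
    exact this ▸ Finset.card_image_le
  have hz : ((F.image (fun p => p.2)).image Prod.snd).card
      ≤ (F.image (fun p => (p.2.2, p.1))).card := by
    have : (F.image (fun p => p.2)).image Prod.snd
        = (F.image (fun p => (p.2.2, p.1))).image Prod.fst := by
      simp only [Finset.image_image, Function.comp_def]
    exact this ▸ Finset.card_image_le
  have hprod := card_le_card_image_fst_mul_card_image_snd (F.image (fun p => p.2))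
  rw [hcard] at hprod
  calc F.card ^ 2 = F.card * F.card := sq _
    _ ≤ M * ((F.image (fun p => (p.1, p.2.1))).card * (F.image (fun p => (p.2.2, p.1))).card) :=
      Nat.mul_le_mul hle (hprod.trans (Nat.mul_le_mul hy hz))
    _ = _ := by ring
end

section
/- Let n ≥ 1, let f : 2^[n] → ℝ be submodular with f(∅) = 0, and let γ be a fractional partition with respect to a finite family 𝓕 of nonempty subsets of [n]. Then Σ_{S ∈ 𝓕} γ(S)·f(S | S^c \ >S) ≤ f([n]) ≤ Σ_{S ∈ 𝓕} γ(S)·f(S | <S). -/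
/-- `<S` : the set of indices smaller than every index of `S`. -/
def ltSet {n : ℕ} (S : Finset (Fin n)) : Finset (Fin n) :=
  Finset.univ.filter (fun i => ∀ j ∈ S, i < j)

/-- `>S` : the set of indices greater than every index of `S`. -/
def gtSet {n : ℕ} (S : Finset (Fin n)) : Finset (Fin n) :=
  Finset.univ.filter (fun i => ∀ j ∈ S, j < i)

open Finset in
/-- Chain bound from below: if `A` precedes `S`, each marginal gain along `S` dominates the
marginal gain over the full initial segment. -/
theorem sum_marginal_le_of_subset_Iio {α : Type*} [LinearOrder α] [LocallyFiniteOrderBot α]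
    (f : Finset α → ℝ) (hsub : ∀ S T : Finset α, f S + f T ≥ f (S ∪ T) + f (S ∩ T))
    (A S : Finset α) (hA : ∀ i ∈ S, A ⊆ Iio i) :
    ∑ i ∈ S, (f (Iic i) - f (Iio i)) ≤ f (S ∪ A) - f A := by
  induction S using Finset.induction_on_max with
  | empty => simp
  | insert a s hlt ih =>
    have ha : a ∉ s := fun h => lt_irrefl a (hlt a h)
    have hAa : ∀ x ∈ A, x < a := fun x hx => mem_Iio.1 (hA a (mem_insert_self a s) hx)
    specialize ih fun i hi => hA i (mem_insert_of_mem hi)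
    have h := hsub (insert a s ∪ A) (Iio a)
    have h1 : insert a s ∪ A ∪ Iio a = Iic a := by
      ext x
      simp only [mem_union, mem_insert, mem_Iio, mem_Iic]
      grind
    have h2 : (insert a s ∪ A) ∩ Iio a = s ∪ A := by
      ext x
      simp only [mem_union, mem_insert, mem_Iio, mem_inter]
      grind
    rw [h1, h2] at h
    rw [sum_insert ha]
    linarith

open Finset in
/-- Chain bound from above: if `A` is disjoint from `S` and `S ∪ A` contains every predecessor of
an element of `S`, each marginal gain along `S` is at most the marginal gain over the full initial
segment. -/
theorem le_sum_marginal_of_Iio_subset {α : Type*} [LinearOrder α] [LocallyFiniteOrderBot α]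
    (f : Finset α → ℝ) (hsub : ∀ S T : Finset α, f S + f T ≥ f (S ∪ T) + f (S ∩ T))
    (A S : Finset α) (hdisj : ∀ i ∈ S, i ∉ A) (hA : ∀ i ∈ S, Iio i ⊆ S ∪ A) :
    f (S ∪ A) - f A ≤ ∑ i ∈ S, (f (Iic i) - f (Iio i)) := by
  induction S using Finset.induction_on_max with
  | empty => simp
  | insert a s hlt ih =>
    have ha : a ∉ s := fun h => lt_irrefl a (hlt a h)
    have haA : a ∉ A := hdisj a (mem_insert_self a s)
    have hmem : ∀ i ∈ insert a s, ∀ x, x < i → x = a ∨ x ∈ s ∨ x ∈ A := fun i hi x hx => by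
      simpa [or_assoc] using hA i hi (mem_Iio.2 hx)
    have hIio : ∀ i ∈ s, Iio i ⊆ s ∪ A := fun i hi x hx => by
      have hxi := mem_Iio.1 hx
      have hxa : x ≠ a := (hxi.trans (hlt i hi)).ne
      simpa [hxa] using hmem i (mem_insert_of_mem hi) x hxi
    specialize ih (fun i hi => hdisj i (mem_insert_of_mem hi)) hIio
    have hpred := hmem a (mem_insert_self a s)
    have h := hsub (Iic a) (s ∪ A)
    have h1 : Iic a ∪ (s ∪ A) = insert a s ∪ A := by
      ext x
      simp only [mem_union, mem_insert, mem_Iic]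
      grind
    have h2 : Iic a ∩ (s ∪ A) = Iio a := by
      ext x
      simp only [mem_union, mem_Iio, mem_Iic, mem_inter]
      grind
    rw [h1, h2] at h
    rw [sum_insert ha]
    linarith

/-- Averaging an additive function over a fractional partition gives its total. -/
theorem sum_mul_sum_of_fractional_partition {ι : Type*} [Fintype ι] [DecidableEq ι]
    (𝓕 : Finset (Finset ι)) (γ : Finset ι → ℝ)
    (hfrac : ∀ i : ι, ∑ S ∈ 𝓕.filter (fun S => i ∈ S), γ S = 1) (d : ι → ℝ) :
    ∑ S ∈ 𝓕, γ S * ∑ i ∈ S, d i = ∑ i, d i := by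
  simp_rw [Finset.mul_sum]
  rw [Finset.sum_comm' (t' := Finset.univ) (s' := fun i => 𝓕.filter (fun S => i ∈ S))
    (by simp)]
  simp [← Finset.sum_mul, hfrac]

/-- strong form of the Madiman–Tetali inequalities. -/
theorem stmt_16 (n : ℕ) (hn : 1 ≤ n)
    (f : Finset (Fin n) → ℝ)
    (hsub : ∀ S T : Finset (Fin n), f S + f T ≥ f (S ∪ T) + f (S ∩ T))
    (hf0 : f ∅ = 0)
    (𝓕 : Finset (Finset (Fin n))) (h𝓕 : ∀ S ∈ 𝓕, S.Nonempty)
    (γ : Finset (Fin n) → ℝ) (hγ : ∀ S ∈ 𝓕, 0 ≤ γ S)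
    (hfrac : ∀ i : Fin n, ∑ S ∈ 𝓕.filter (fun S => i ∈ S), γ S = 1) :
    (∑ S ∈ 𝓕, γ S * (f (S ∪ (Sᶜ \ gtSet S)) - f (Sᶜ \ gtSet S)) ≤
        f Finset.univ) ∧
      (f Finset.univ ≤ ∑ S ∈ 𝓕, γ S * (f (S ∪ ltSet S) - f (ltSet S))) := by
  have htotal : ∑ i, (f (Finset.Iic i) - f (Finset.Iio i)) = f Finset.univ := by
    have h1 := sum_marginal_le_of_subset_Iio f hsub ∅ Finset.univ (by simp)
    have h2 := le_sum_marginal_of_Iio_subset f hsub ∅ Finset.univ (by simp) (by simp)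
    rw [Finset.union_empty, hf0, sub_zero] at h1 h2
    exact le_antisymm h1 h2
  rw [← htotal, ← sum_mul_sum_of_fractional_partition 𝓕 γ hfrac]
  refine ⟨Finset.sum_le_sum fun S hS => mul_le_mul_of_nonneg_left ?_ (hγ S hS),
    Finset.sum_le_sum fun S hS => mul_le_mul_of_nonneg_left ?_ (hγ S hS)⟩
  · refine le_sum_marginal_of_Iio_subset f hsub _ S (fun i hi => by simp [hi]) fun i hi x hx => ?_
    by_cases hxS : x ∈ S
    · simp [hxS]
    · have hxi := Finset.mem_Iio.1 hx
      simp only [gtSet, Finset.mem_union, Finset.mem_sdiff, Finset.mem_compl, Finset.mem_filter]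
      exact Or.inr ⟨hxS, fun h => lt_asymm hxi (h.2 i hi)⟩
  · refine sum_marginal_le_of_subset_Iio f hsub _ S fun i hi x hx => ?_
    exact Finset.mem_Iio.2 ((Finset.mem_filter.1 hx).2 i hi)
end
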